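/- Let α ∈ (0,1) be irrational with infinite continued fraction expansion α = [0; e₁, e₂, e₃, …], let ρ ∈ [0,1), and let s = s_{α,ρ} be the Sturmian word of slope α and intercept ρ. For each ℓ ≥ 2 there exists an integer k_ℓ ≥ 1 such that for every k ≥ k_ℓ there exist an irrational β ∈ (0,1) whose continued fraction expansion is β = [0; e_{k+1}+1, e_{k+2}, e_{k+3}, …], and a map h assigning to each letter of {0,1} a nonempty finite word over the collection of subsets of {0,1}^ℓ × {0,1}^ℓ, such that the shifted ℓ-boundary sequence (∂_{s,ℓ}[n])_{n≥ℓ+1} equals the infinite concatenation h(c_β[0]) h(c_β[1]) h(c_β[2]) ⋯, where c_β is the characteristic Sturmian word of slope β. -/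

import Mathlib

/-- The Sturmian word of slope `α` and intercept `ρ`:
`s[n] = 0` iff `{ρ + nα} ∈ [0, 1−α)`. -/
noncomputable def sturmian (α ρ : ℝ) (n : ℕ) : Fin 2 :=
  if Int.fract (ρ + n * α) < 1 - α then 0 else 1

/-- The `n`-th boundary set of the infinite word `x` with window length `ℓ`. -/
def boundarySet {A : Type*} (x : ℕ → A) (ℓ n : ℕ) :
    Set ((Fin ℓ → A) × (Fin ℓ → A)) :=
  {p | ∃ i : ℕ, (∀ k : Fin ℓ, p.1 k = x (i + k)) ∧ (∀ k : Fin ℓ, p.2 k = x (i + n + k))}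

/-- The Gauss map `x ↦ {1/x}` governing continued fraction expansions:
for an irrational `x ∈ (0,1)` with `x = [0; e₁, e₂, …]` one has
`eₖ₊₁ = ⌊1 / G^k(x)⌋` for all `k ≥ 0`. -/
noncomputable def gaussMap (x : ℝ) : ℝ := Int.fract (1 / x)

/-- The interval letter of a real number read modulo one, so that
`sturmian α ρ n = rotationLetter α (ρ + n * α)`. -/
noncomputable def rotationLetter (α y : ℝ) : Fin 2 :=
  if Int.fract y < 1 - α then 0 else 1

theorem rotationLetter_add_intCast (α y : ℝ) (m : ℤ) :
    rotationLetter α (y + m) = rotationLetter α y := by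
  simp [rotationLetter]

theorem fract_lt_one_sub_iff {α : ℝ} (h0 : 0 < α) (y : ℝ) :
    Int.fract y < 1 - α ↔ ⌊y + α⌋ = ⌊y⌋ := by
  rw [Int.floor_eq_iff, Int.fract]
  have := Int.floor_le y
  constructor
  · intro h
    constructor <;> linarith
  · rintro ⟨_, h⟩
    linarith

theorem floor_eq_of_no_int_mem_Ioc {y z : ℝ} (hyz : y ≤ z)
    (h : ∀ m : ℤ, y < m → (m : ℝ) ≤ z → False) : ⌊y⌋ = ⌊z⌋ := by
  refine le_antisymm (Int.floor_le_floor hyz) (Int.le_floor.2 ?_)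
  by_contra! hlt
  exact h _ hlt (Int.floor_le z)

/-- The word of length `ℓ` read from a real number by the rotation of angle `α` is constant on
intervals without a point `m - j * α`, `j ≤ ℓ`, except possibly the left end point. -/
theorem rotationLetter_eq_of_no_break {α : ℝ} (h0 : 0 < α) {ℓ : ℕ} {y z : ℝ} (hyz : y ≤ z)
    (h : ∀ (j : ℕ) (m : ℤ), j ≤ ℓ → y < m - j * α → m - j * α ≤ z → False)
    {k : ℕ} (hk : k < ℓ) :
    rotationLetter α (y + k * α) = rotationLetter α (z + k * α) := by
  have key : ∀ j : ℕ, j ≤ ℓ → ⌊y + j * α⌋ = ⌊z + j * α⌋ := fun j hj =>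
    floor_eq_of_no_int_mem_Ioc (by linarith) fun m h1 h2 =>
      h j m hj (by linarith) (by linarith)
  have h1 := key k hk.le
  have h2 := key (k + 1) hk
  have e1 : ∀ w : ℝ, w + ((k + 1 : ℕ) : ℝ) * α = w + k * α + α := fun w => by push_cast; ring
  rw [e1, e1] at h2
  simp only [rotationLetter, fract_lt_one_sub_iff h0, h1, h2]

theorem exists_greatest_break_le (α : ℝ) (ℓ : ℕ) (X : ℝ) :
    ∃ (j : ℕ) (m : ℤ), j ≤ ℓ ∧ m - j * α ≤ X ∧
      ∀ (i : ℕ) (n : ℤ), i ≤ ℓ → m - j * α < n - i * α → n - i * α ≤ X → False := by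
  obtain ⟨j, hj, hmax⟩ := Finset.exists_max_image (Finset.range (ℓ + 1))
    (fun j : ℕ => (⌊X + j * α⌋ : ℝ) - j * α) ⟨0, by simp⟩
  refine ⟨j, ⌊X + j * α⌋, by simpa [Nat.lt_succ_iff] using hj, ?_, ?_⟩
  · linarith [Int.floor_le (X + j * α)]
  · intro i n hi h1 h2
    have h3 := hmax i (by simpa [Nat.lt_succ_iff] using hi)
    have h4 : n ≤ ⌊X + i * α⌋ := Int.le_floor.2 (by linarith)
    have h5 : (n : ℝ) ≤ ⌊X + i * α⌋ := by exact_mod_cast h4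
    linarith

theorem exists_gt_no_break (α : ℝ) (ℓ : ℕ) (X : ℝ) :
    ∃ d : ℝ, X < d ∧
      ∀ (i : ℕ) (n : ℤ), i ≤ ℓ → X < n - i * α → n - i * α < d → False := by
  obtain ⟨j, hj, hmin⟩ := Finset.exists_min_image (Finset.range (ℓ + 1))
    (fun j : ℕ => (⌊X + j * α⌋ : ℝ) + 1 - j * α) ⟨0, by simp⟩
  refine ⟨⌊X + j * α⌋ + 1 - j * α, by linarith [Int.lt_floor_add_one (X + j * α)], ?_⟩
  intro i n hi h1 h2
  have h3 := hmin i (by simpa [Nat.lt_succ_iff] using hi)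
  have h4 : ⌊X + i * α⌋ < n := Int.floor_lt.2 (by linarith)
  have h5 : (⌊X + i * α⌋ : ℝ) + 1 ≤ n := by exact_mod_cast h4
  linarith

theorem exists_rotation_orbit_mem_Ioo {α : ℝ} (hirr : Irrational α) (ρ : ℝ) {A B : ℝ}
    (hAB : A < B) : ∃ (i : ℕ) (m : ℤ), A < ρ + i * α + m ∧ ρ + i * α + m < B := by
  have hd : DenseRange (fun i : ℕ => i • (α : AddCircle (1 : ℝ))) :=
    denseRange_zsmul_iff_nsmul.1 (AddCircle.denseRange_zsmul_coe_iff.2 (by simpa using hirr))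
  obtain ⟨i, y, ⟨hy1, hy2⟩, hy⟩ := hd.exists_mem_open
    (QuotientAddGroup.isOpenMap_coe _ (isOpen_Ioo (a := A - ρ) (b := B - ρ)))
    ((Set.nonempty_Ioo.2 (by linarith)).image _)
  have hz : ((y - i * α : ℝ) : AddCircle (1 : ℝ)) = 0 := by
    rw [← nsmul_eq_mul, AddCircle.coe_sub, AddCircle.coe_nsmul]
    exact sub_eq_zero.2 hy
  obtain ⟨m, hm⟩ := (AddCircle.coe_eq_zero_iff _).1 hz
  rw [zsmul_eq_mul, mul_one] at hm
  exact ⟨i, m, by linarith, by linarith⟩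

theorem boundarySet_subset_of_no_break {α : ℝ} (h0 : 0 < α) (hirr : Irrational α) (ρ : ℝ)
    (ℓ : ℕ) {n n' : ℕ} {m m' : ℤ}
    (h : ∀ j r : ℤ, |j| ≤ ℓ →
      (j * α + r : ℝ) ∉ Set.uIcc (n * α + m : ℝ) (n' * α + m' : ℝ)) :
    boundarySet (sturmian α ρ) ℓ n ⊆ boundarySet (sturmian α ρ) ℓ n' := by
  rintro ⟨u, v⟩ ⟨i, hu, hv⟩
  simp only at hu hv
  have hs : ∀ t : ℕ, sturmian α ρ t = rotationLetter α (ρ + t * α) := fun t => rfl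
  set x : ℝ := n * α + m with hx
  set x' : ℝ := n' * α + m' with hx'
  set X : ℝ := ρ + i * α with hX
  have hu' : ∀ k : Fin ℓ, u k = rotationLetter α (X + (k : ℕ) * α) := by
    intro k
    rw [hu, hs]
    congr 1
    push_cast
    ring
  have hv' : ∀ k : Fin ℓ, v k = rotationLetter α (X + x + (k : ℕ) * α) := by
    intro k
    rw [hv, hs, ← rotationLetter_add_intCast α _ m]
    congr 1
    push_cast
    ring
  obtain ⟨j₁, m₁, hj₁, hle₁, hbr₁⟩ := exists_greatest_break_le α ℓ X
  obtain ⟨j₂, m₂, hj₂, hle₂, hbr₂⟩ := exists_greatest_break_le α ℓ (X + x)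
  set c : ℝ := m₁ - j₁ * α with hc
  set c' : ℝ := m₂ - j₂ * α with hc'
  set M : ℝ := max c (c' - x') with hM
  have hcM : c ≤ M := le_max_left _ _
  have hcM' : c' ≤ M + x' := by linarith [le_max_right c (c' - x')]
  have hb₁ : ∀ (j : ℕ) (r : ℤ), j ≤ ℓ → c < r - j * α → r - j * α ≤ M → False := by
    intro j r hj hlt hle
    have h1 : X < r - j * α := by
      by_contra! hcon
      exact hbr₁ j r hj hlt hcon
    have h2 : (r : ℝ) - j * α ≤ c' - x' := by
      rcases le_max_iff.1 hle with h | h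
      · linarith
      · exact h
    refine h ((j : ℤ) - j₂) (m₂ - r) (by rw [abs_le]; constructor <;> omega) ?_
    refine Set.mem_uIcc.2 (Or.inr ?_)
    push_cast
    constructor <;> linarith
  have hb₂ : ∀ (j : ℕ) (r : ℤ), j ≤ ℓ → c' < r - j * α → r - j * α ≤ M + x' → False := by
    intro j r hj hlt hle
    have h1 : X + x < r - j * α := by
      by_contra! hcon
      exact hbr₂ j r hj hlt hcon
    have h2 : (r : ℝ) - j * α - x' ≤ c := by
      rcases le_max_iff.1 (show (r : ℝ) - j * α - x' ≤ max c (c' - x') by linarith) with h | h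
      · exact h
      · linarith
    refine h ((j₁ : ℤ) - j) (r - m₁) (by rw [abs_le]; constructor <;> omega) ?_
    refine Set.mem_uIcc.2 (Or.inl ?_)
    push_cast
    constructor <;> linarith
  obtain ⟨d₁, hd₁, hbd₁⟩ := exists_gt_no_break α ℓ M
  obtain ⟨d₂, hd₂, hbd₂⟩ := exists_gt_no_break α ℓ (M + x')
  obtain ⟨i', s, hlo, hhi⟩ := exists_rotation_orbit_mem_Ioo hirr ρ
    (show M < min d₁ (d₂ - x') from lt_min hd₁ (by linarith))
  have hhi₁ := hhi.trans_le (min_le_left _ _)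
  have hhi₂ := hhi.trans_le (min_le_right _ _)
  refine ⟨i', fun k => ?_, fun k => ?_⟩
  · have e1 := rotationLetter_eq_of_no_break h0 hle₁ hbr₁ k.2
    have e2 := rotationLetter_eq_of_no_break h0 hcM hb₁ k.2
    have e3 := rotationLetter_eq_of_no_break h0 hlo.le
      (fun j r hj h1 h2 => hbd₁ j r hj h1 (by linarith)) k.2
    simp only
    rw [hu', ← e1, e2, e3, hs, ← rotationLetter_add_intCast α (ρ + (i' + k : ℕ) * α) s]
    congr 1
    push_cast
    ring
  · have e1 := rotationLetter_eq_of_no_break h0 hle₂ hbr₂ k.2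
    have e2 := rotationLetter_eq_of_no_break h0 hcM' hb₂ k.2
    have e3 := rotationLetter_eq_of_no_break h0
      (show M + x' ≤ ρ + i' * α + s + x' by linarith)
      (fun j r hj h1 h2 => hbd₂ j r hj h1 (by linarith)) k.2
    simp only
    rw [hv', ← e1, e2, e3, hs, ← rotationLetter_add_intCast α (ρ + (i' + n' + k : ℕ) * α) (s + m')]
    congr 1
    push_cast
    ring

theorem boundarySet_eq_of_no_break {α : ℝ} (h0 : 0 < α) (hirr : Irrational α) (ρ : ℝ)
    (ℓ : ℕ) {n n' : ℕ} {m m' : ℤ}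
    (h : ∀ j r : ℤ, |j| ≤ ℓ →
      (j * α + r : ℝ) ∉ Set.uIcc (n * α + m : ℝ) (n' * α + m' : ℝ)) :
    boundarySet (sturmian α ρ) ℓ n = boundarySet (sturmian α ρ) ℓ n' :=
  (boundarySet_subset_of_no_break h0 hirr ρ ℓ h).antisymm
    (boundarySet_subset_of_no_break h0 hirr ρ ℓ fun j r hj => Set.uIcc_comm (_ : ℝ) _ ▸ h j r hj)

theorem gaussMap_iterate_mem {α : ℝ} (h0 : 0 < α) (h1 : α < 1) (hirr : Irrational α) (k : ℕ) :
    0 < gaussMap^[k] α ∧ gaussMap^[k] α < 1 ∧ Irrational (gaussMap^[k] α) := by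
  induction k with
  | zero => exact ⟨h0, h1, hirr⟩
  | succ k ih =>
    rw [Function.iterate_succ_apply']
    have hi : Irrational (gaussMap (gaussMap^[k] α)) := by
      have h2 : Irrational (1 / gaussMap^[k] α) := by simpa using ih.2.2
      exact h2.sub_intCast _
    exact ⟨lt_of_le_of_ne (Int.fract_nonneg _) hi.ne_zero.symm, Int.fract_lt_one _, hi⟩

/-- Consecutive convergents `p' / q'`, `p / q` of `α`, characterised by unimodularity and the
ratio of their errors. -/
theorem exists_consecutive_convergents {α : ℝ} (h0 : 0 < α) (h1 : α < 1) (hirr : Irrational α)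
    (k : ℕ) :
    ∃ (q q' : ℕ) (p p' : ℤ), 1 ≤ q ∧ k ≤ q ∧ k ≤ q' + 1 ∧ (1 ≤ k → 1 ≤ q') ∧
      (q * p' - q' * p : ℤ) ^ 2 = 1 ∧ (q' * α - p' : ℝ) ≠ 0 ∧
      (q * α - p : ℝ) = -(gaussMap^[k] α) * (q' * α - p') := by
  induction k with
  | zero => exact ⟨1, 0, 0, 1, by simp⟩
  | succ k ih =>
    obtain ⟨q, q', p, p', hq, hkq, hkq', hq', hdet, hne, hrat⟩ := ih
    obtain ⟨hg0, hg1, -⟩ := gaussMap_iterate_mem h0 h1 hirr k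
    rw [Function.iterate_succ_apply']
    set g := gaussMap^[k] α
    have hfl : 1 ≤ ⌊1 / g⌋ := Int.le_floor.2 (by rw [le_div_iff₀ hg0]; push_cast; linarith)
    obtain ⟨a, ha⟩ := Int.eq_ofNat_of_zero_le (show 0 ≤ ⌊1 / g⌋ by omega)
    have ha1 : 1 ≤ a := by omega
    have haq : q ≤ a * q := Nat.le_mul_of_pos_left q ha1
    refine ⟨a * q + q', q, a * p + p', p, by omega, by omega, by omega, by omega, ?_, ?_, ?_⟩
    · rw [← hdet]
      push_cast
      ring
    · rw [hrat]
      exact mul_ne_zero (neg_ne_zero.2 hg0.ne') hne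
    · have hgm : gaussMap g = 1 / g - a := by
        rw [gaussMap, Int.fract, ha]
        simp
      rw [hgm, hrat]
      push_cast
      have : (a * q + q') * α - (a * p + p') = a * (q * α - p) + (q' * α - p') := by ring
      rw [this, hrat]
      field_simp
      ring

/-- Among the multiples `r * α` with `1 ≤ r < q + q'`, none lies modulo one strictly between the
errors of the consecutive convergents `p / q` and `p' / q'`. -/
theorem convergent_sum_le_of_between {α g : ℝ} (hg0 : 0 < g) {q q' : ℕ} {p p' : ℤ}
    (hdet : (q * p' - q' * p : ℤ) ^ 2 = 1) (hne : (q' * α - p' : ℝ) ≠ 0)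
    (hrat : (q * α - p : ℝ) = -g * (q' * α - p')) {r m : ℤ} (hr : 1 ≤ r) {u : ℝ}
    (hu0 : 0 < u) (hu1 : u < 1)
    (h : r * α - m = (q * α - p) * (1 - u) + (q' * α - p') * u) : (q + q' : ℤ) ≤ r := by
  obtain ⟨D, hD⟩ : ∃ D : ℤ, D = q * p' - q' * p := ⟨_, rfl⟩
  rw [← hD] at hdet
  obtain ⟨s, hs⟩ : ∃ s : ℤ, s = D * (r * p' - m * q') := ⟨_, rfl⟩
  obtain ⟨t, ht⟩ : ∃ t : ℤ, t = D * (q * m - p * r) := ⟨_, rfl⟩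
  have hrst : r = s * q + t * q' := by
    rw [hs, ht]
    linear_combination (-r) * hdet + D * r * hD
  have hmst : m = s * p + t * p' := by
    rw [hs, ht]
    linear_combination (-m) * hdet + D * m * hD
  have key : (t : ℝ) - g * s = u - g * (1 - u) := by
    apply mul_left_cancel₀ hne
    rw [hrat, hrst, hmst] at h
    push_cast at h
    linear_combination h + (-(s : ℝ)) * hrat
  rcases le_or_gt 1 s with hs1 | hs0
  · have hs1' : (1 : ℝ) ≤ s := by exact_mod_cast hs1
    have htpos : (0 : ℝ) < t := by nlinarith [mul_nonneg hg0.le (sub_nonneg.2 hs1'), mul_pos hg0 hu0]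
    have ht1 : 1 ≤ t := by exact_mod_cast htpos
    rw [hrst]
    nlinarith [Int.natCast_nonneg q, Int.natCast_nonneg q']
  · have hs0' : (s : ℝ) ≤ 0 := by exact_mod_cast Int.lt_add_one_iff.1 hs0
    have htlt : (t : ℝ) < 1 := by
      nlinarith [mul_nonneg hg0.le (neg_nonneg.2 hs0'), mul_pos hg0 (sub_pos.2 hu1)]
    have ht0 : t ≤ 0 := by
      have : t < 1 := by exact_mod_cast htlt
      omega
    nlinarith [Int.natCast_nonneg q, Int.natCast_nonneg q']

/-- Adding `q` or `q'` according to the letters of the characteristic word of slope `β` moves the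
multiples of `α`, modulo one, as an affine copy of the rotation of angle `β`. -/
theorem exists_int_add_convergent_orbit {α β : ℝ} (hβ0 : 0 < β) (hβ1 : β < 1) {q q' : ℕ}
    {p p' : ℤ} (hstep : ((q * α - p) - (q' * α - p')) * β = q * α - p)
    {len : Fin 2 → ℕ} {L : ℕ → ℕ} (hL0 : L 0 = 0) (hlen0 : len 0 = q) (hlen1 : len 1 = q')
    (hLs : ∀ n, L (n + 1) = L n + len (sturmian β β n)) (n : ℕ) :
    ∃ m : ℤ, L n * α + m =
      ((q * α - p) - (q' * α - p')) * Int.fract (β + n * β) - (q * α - p) := by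
  induction n with
  | zero =>
    refine ⟨0, ?_⟩
    have : Int.fract β = β := Int.fract_eq_self.2 ⟨hβ0.le, hβ1⟩
    simp [hL0, this, hstep]
  | succ n ih =>
    obtain ⟨m, hm⟩ := ih
    have e1 : β + ((n + 1 : ℕ) : ℝ) * β = (β + n * β) + β := by push_cast; ring
    have hfr := Int.fract_nonneg (β + n * β)
    have hfr1 := Int.fract_lt_one (β + n * β)
    rw [hLs, e1]
    by_cases hlt : Int.fract (β + n * β) < 1 - β
    · have e2 : Int.fract (β + n * β + β) = Int.fract (β + n * β) + β := by
        rw [Int.fract_eq_iff]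
        refine ⟨by linarith, by linarith, ⌊β + n * β⌋, ?_⟩
        rw [Int.fract]
        ring
      refine ⟨m - p, ?_⟩
      rw [e2]
      simp only [sturmian, if_pos hlt, hlen0]
      push_cast
      linear_combination hm - hstep
    · have e2 : Int.fract (β + n * β + β) = Int.fract (β + n * β) + β - 1 := by
        rw [Int.fract_eq_iff]
        refine ⟨by linarith, by linarith, ⌊β + n * β⌋ + 1, ?_⟩
        rw [Int.fract]
        push_cast
        ring
      refine ⟨m - p', ?_⟩
      rw [e2]
      simp only [sturmian, if_neg hlt, hlen1]
      push_cast
      linear_combination hm - hstep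

/-- let `s` be a Sturmian word of irrational slope
`α = [0; e₁, e₂, …] ∈ (0,1)` and intercept `ρ`, and let `ℓ ≥ 2`. Then there is
`k_ℓ ≥ 1` such that for each `k ≥ k_ℓ` there are an irrational `β ∈ (0,1)` with
continued fraction expansion `[0; e_{k+1}+1, e_{k+2}, …]` and a map `h` from `{0,1}`
to nonempty finite words over the boundary-set alphabet such that the shifted
`ℓ`-boundary sequence `(∂_{s,ℓ}[n])_{n ≥ ℓ+1}` is the infinite concatenation
`h(c_β[0]) h(c_β[1]) ⋯`, where `c_β` is the characteristic Sturmian word of slope `β`. -/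
theorem stmt15 (α : ℝ) (hα0 : 0 < α) (hα1 : α < 1) (hirr : Irrational α)
    (ρ : ℝ) (hρ0 : 0 ≤ ρ) (hρ1 : ρ < 1)
    (e : ℕ → ℕ) (he : ∀ k : ℕ, (e (k + 1) : ℤ) = ⌊1 / (gaussMap^[k] α)⌋)
    (ℓ : ℕ) (hℓ : 2 ≤ ℓ) :
    ∃ kℓ : ℕ, 1 ≤ kℓ ∧ ∀ k : ℕ, kℓ ≤ k →
      ∃ β : ℝ, 0 < β ∧ β < 1 ∧ Irrational β ∧
        ((e (k + 1) + 1 : ℤ) = ⌊1 / β⌋) ∧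
        (∀ j : ℕ, 1 ≤ j → (e (k + 1 + j) : ℤ) = ⌊1 / (gaussMap^[j] β)⌋) ∧
        ∃ h : Fin 2 → List (Set ((Fin ℓ → Fin 2) × (Fin ℓ → Fin 2))),
          (∀ a : Fin 2, h a ≠ []) ∧
          ∃ L : ℕ → ℕ, L 0 = 0 ∧
            (∀ n : ℕ, L (n + 1) = L n + (h (sturmian β β n)).length) ∧
            (∀ (n p : ℕ) (hp : p < (h (sturmian β β n)).length),
              boundarySet (sturmian α ρ) ℓ (L n + p + ℓ + 1) =
                (h (sturmian β β n)).get ⟨p, hp⟩) := by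
  refine ⟨2 * ℓ + 2, by omega, fun k hk => ?_⟩
  obtain ⟨hg0, hg1, hgi⟩ := gaussMap_iterate_mem hα0 hα1 hirr k
  obtain ⟨q, q', p, p', hq, hkq, hkq', -, hdet, hne, hrat⟩ :=
    exists_consecutive_convergents hα0 hα1 hirr k
  have hek := he k
  have hej : ∀ j : ℕ, (e (k + 1 + j) : ℤ) = ⌊1 / (gaussMap^[j] (gaussMap^[k] α))⌋ := by
    intro j
    rw [← Function.iterate_add_apply, ← he, show j + k + 1 = k + 1 + j by omega]
  set g := gaussMap^[k] α
  obtain ⟨β, hβ⟩ : ∃ β : ℝ, β = g / (1 + g) := ⟨_, rfl⟩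
  have hβinv : 1 / β = 1 / g + 1 := by
    rw [hβ]
    field_simp
  have hβ0 : 0 < β := hβ ▸ by positivity
  have hβ1 : β < 1 := by
    rw [hβ, div_lt_one (by linarith)]
    linarith
  have hβi : Irrational β := by
    have h1 : Irrational (1 / g) := by simpa using hgi
    have h2 : Irrational (1 / β) := by
      rw [hβinv]
      exact_mod_cast h1.add_natCast 1
    simpa using h2
  have hβg : gaussMap β = gaussMap g := by
    rw [gaussMap, hβinv, gaussMap, Int.fract_add_one]
  refine ⟨β, hβ0, hβ1, hβi, by rw [hβinv, Int.floor_add_one, ← hek], ?_, ?_⟩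
  · intro j hj
    obtain ⟨i, rfl⟩ := Nat.exists_eq_add_of_le' hj
    rw [hej, Function.iterate_succ_apply, Function.iterate_succ_apply, hβg]
  set len : Fin 2 → ℕ := fun a => if a = 0 then q else q' with hlen
  set f : ℕ → Set ((Fin ℓ → Fin 2) × (Fin ℓ → Fin 2)) :=
    fun i => boundarySet (sturmian α ρ) ℓ (i + ℓ + 1) with hf
  have hlen_pos : ∀ a, 0 < len a := fun a => by
    simp only [hlen]
    split_ifs <;> omega
  have hlen_lt : ∀ a, len a + 2 * ℓ < q + q' := fun a => by
    simp only [hlen]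
    split_ifs <;> omega
  set L : ℕ → ℕ := fun n => ∑ i ∈ Finset.range n, len (sturmian β β i) with hL
  have hLs : ∀ n, L (n + 1) = L n + len (sturmian β β n) := fun n => Finset.sum_range_succ _ _
  have hstep : ((q * α - p) - (q' * α - p')) * β = q * α - p := by
    rw [hrat, hβ]
    field_simp
    ring
  have hL0 : L 0 = 0 := by simp [hL]
  have horbit := exists_int_add_convergent_orbit hβ0 hβ1 hstep hL0 (len := len)
    (by simp [hlen]) (by simp [hlen]) hLs
  have hfract : ∀ n : ℕ, 0 < Int.fract (β + n * β) ∧ Int.fract (β + n * β) < 1 := by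
    intro n
    refine ⟨lt_of_le_of_ne (Int.fract_nonneg _) (Ne.symm ?_), Int.fract_lt_one _⟩
    have h1 : Irrational (((n + 1 : ℕ) : ℝ) * β) := hβi.natCast_mul (Nat.succ_ne_zero n)
    have h2 : β + n * β = ((n + 1 : ℕ) : ℝ) * β := by push_cast; ring
    rw [h2]
    exact (h1.sub_intCast _).ne_zero
  have hperiod : ∀ n i : ℕ, i < len (sturmian β β n) → f (L n + i) = f i := by
    intro n i hi
    obtain ⟨m, hm⟩ := horbit n
    obtain ⟨m₀, hm₀⟩ := horbit 0
    obtain ⟨hn0, hn1⟩ := hfract n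
    obtain ⟨hz0, hz1⟩ := hfract 0
    rw [hL0] at hm₀
    simp only [hf]
    refine boundarySet_eq_of_no_break hα0 hirr ρ ℓ (m := m) (m' := m₀) fun j r hj hmem => ?_
    rw [← segment_eq_uIcc] at hmem
    obtain ⟨a, b, ha, hb, hab, hsum⟩ := hmem
    obtain ⟨hj1, hj2⟩ := abs_le.1 hj
    set u := Int.fract (β + (n : ℝ) * β)
    set u₀ := Int.fract (β + ((0 : ℕ) : ℝ) * β)
    obtain ⟨hu0, hu1⟩ : a * u + b * u₀ ∈ Set.Ioo (0 : ℝ) 1 :=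
      convex_Ioo (0 : ℝ) 1 ⟨hn0, hn1⟩ ⟨hz0, hz1⟩ ha hb hab
    have hbound := convergent_sum_le_of_between hg0 hdet hne hrat
      (r := i + ℓ + 1 - j) (m := r) (by omega) hu0 hu1 (by
        simp only [smul_eq_mul] at hsum
        push_cast at hsum hm₀ ⊢
        obtain rfl : b = 1 - a := by linarith
        linear_combination hsum - a * hm - (1 - a) * hm₀)
    have := hlen_lt (sturmian β β n)
    omega
  refine ⟨fun a => (List.range (len a)).map f, fun a => ?_, L, hL0, ?_, ?_⟩
  · have := hlen_pos a
    simp only [ne_eq, List.map_eq_nil_iff, List.range_eq_nil]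
    omega
  · intro n
    simpa using hLs n
  · intro n i hi
    have hi' : i < len (sturmian β β n) := by simpa using hi
    have := hperiod n i hi'
    simpa [hf] using this
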